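/- arXiv:1801.00324 — 4 statements merged into one kernel-verified Lean document; each statement's English description precedes it below -/
import Mathlib

section
/- Let n ≥ 4 and let B be a blocker for the triangulations of a convex n-gon. Then there exist a vertex a ∈ ZMod n, an integer m with 1 ≤ m ≤ n−3, and integers i_1, …, i_{n−3−m} with 1 ≤ i_j ≤ m+1 for all j, such that B = {{a+t, a+t+2} : 0 ≤ t ≤ m} ∪ {{a+m+2+j, a+i_j} : 1 ≤ j ≤ n−3−m}, and moreover for all j, k ∈ {1, …, n−3−m}, if |i_j − i_k| ≥ 2 then the diagonals {a+m+2+j, a+i_j} and {a+m+2+k, a+i_k} do not cross. -/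
namespace ConvexBlockers

/-- Cyclic distance between two vertices of the convex `n`-gon (vertices = `ZMod n`). -/
def cyclicDist {n : ℕ} (i j : ZMod n) : ℕ := min (i - j).val (j - i).val

/-- A diagonal: an unordered pair of vertices at cyclic distance at least 2. -/
def IsDiagonal {n : ℕ} (e : Sym2 (ZMod n)) : Prop :=
  ∃ i j : ZMod n, e = s(i, j) ∧ 2 ≤ cyclicDist i j

/-- An ear-cover: a diagonal of cyclic distance exactly 2. -/
def IsEarCover {n : ℕ} (e : Sym2 (ZMod n)) : Prop :=
  ∃ i j : ZMod n, e = s(i, j) ∧ cyclicDist i j = 2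

/-- `Btw a x b` : `x` lies strictly inside the clockwise arc from `a` to `b`. -/
def Btw {n : ℕ} (a x b : ZMod n) : Prop :=
  0 < (x - a).val ∧ (x - a).val < (b - a).val

/-- Two diagonals cross iff their endpoint pairs strictly interleave in the cyclic order. -/
def Crosses {n : ℕ} (e f : Sym2 (ZMod n)) : Prop :=
  ∃ a b c d : ZMod n, e = s(a, b) ∧ f = s(c, d) ∧ Btw a c b ∧ Btw b d a

/-- A triangulation: a maximal (w.r.t. inclusion) set of pairwise non-crossing diagonals. -/
def IsTriangulation {n : ℕ} (T : Set (Sym2 (ZMod n))) : Prop :=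
  (∀ e ∈ T, IsDiagonal e) ∧
  (∀ e ∈ T, ∀ f ∈ T, ¬ Crosses e f) ∧
  (∀ T' : Set (Sym2 (ZMod n)), (∀ e ∈ T', IsDiagonal e) →
    (∀ e ∈ T', ∀ f ∈ T', ¬ Crosses e f) → T ⊆ T' → T' = T)

/-- A blocking set: a set of diagonals meeting every triangulation. -/
def IsBlockingSet {n : ℕ} (B : Set (Sym2 (ZMod n))) : Prop :=
  (∀ e ∈ B, IsDiagonal e) ∧
  ∀ T : Set (Sym2 (ZMod n)), IsTriangulation T → (B ∩ T).Nonempty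

/-- A blocker: a blocking set of minimum possible cardinality. -/
def IsBlocker {n : ℕ} (B : Set (Sym2 (ZMod n))) : Prop :=
  IsBlockingSet B ∧
  ∀ B' : Set (Sym2 (ZMod n)), IsBlockingSet B' → B.ncard ≤ B'.ncard

/-- The pair `a < b` is a diagonal of the convex polygon with (linearly cut) vertex set `S`. -/
def Chord (S : Finset ℕ) (a b : ℕ) : Prop :=
  a ∈ S ∧ b ∈ S ∧ a < b ∧ (∃ x ∈ S, a < x ∧ x < b) ∧ ∃ y ∈ S, y < a ∨ b < y

/-- The pairs `a < b` and `c < d` strictly interleave. -/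
def Interleave (a b c d : ℕ) : Prop :=
  (a < c ∧ c < b ∧ b < d) ∨ (c < a ∧ a < d ∧ d < b)

/-- A triangulation of the convex polygon with vertex set `S`, as a relation on labels. -/
structure IsTri (S : Finset ℕ) (T : ℕ → ℕ → Prop) : Prop where
  chord : ∀ a b, T a b → Chord S a b
  noncross : ∀ a b c d, T a b → T c d → ¬ Interleave a b c d
  maximal : ∀ a b, Chord S a b → T a b ∨ ∃ c d, T c d ∧ Interleave a b c d

open Classical in
/-- The diagonals of the polygon on `S` that satisfy `R`. -/
noncomputable def chords (S : Finset ℕ) (R : ℕ → ℕ → Prop) : Finset (ℕ × ℕ) :=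
  (S ×ˢ S).filter fun p => Chord S p.1 p.2 ∧ R p.1 p.2

theorem mem_chords {S : Finset ℕ} {R : ℕ → ℕ → Prop} {p : ℕ × ℕ} :
    p ∈ chords S R ↔ Chord S p.1 p.2 ∧ R p.1 p.2 := by
  classical
  rw [chords, Finset.mem_filter, Finset.mem_product]
  exact ⟨fun h => h.2, fun h => ⟨⟨h.1.1, h.1.2.1⟩, h⟩⟩

theorem exists_pred {S : Finset ℕ} {v : ℕ} (h : ∃ a ∈ S, a < v) :
    ∃ x ∈ S, x < v ∧ ∀ z ∈ S, z < v → z ≤ x := by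
  classical
  obtain ⟨a, ha, hav⟩ := h
  obtain ⟨x, hx, hmax⟩ := (S.filter (· < v)).exists_max_image id ⟨a, by simp [ha, hav]⟩
  simp only [Finset.mem_filter, id] at hx hmax
  exact ⟨x, hx.1, hx.2, fun z hz hzv => hmax z ⟨hz, hzv⟩⟩

theorem exists_succ {S : Finset ℕ} {v : ℕ} (h : ∃ b ∈ S, v < b) :
    ∃ y ∈ S, v < y ∧ ∀ z ∈ S, v < z → y ≤ z := by
  classical
  obtain ⟨b, hb, hvb⟩ := h
  obtain ⟨y, hy, hmin⟩ := (S.filter (v < ·)).exists_min_image id ⟨b, by simp [hb, hvb]⟩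
  simp only [Finset.mem_filter, id] at hy hmin
  exact ⟨y, hy.1, hy.2, fun z hz hvz => hmin z ⟨hz, hvz⟩⟩

theorem IsTri.fan {S : Finset ℕ} {v : ℕ} (hv : v ∈ S) :
    IsTri S fun a b => Chord S a b ∧ (a = v ∨ b = v) where
  chord _ _ h := h.1
  noncross a b c d h h' := by
    have := h.1.2.2.1
    have := h'.1.2.2.1
    unfold Interleave
    omega
  maximal a b h := by
    obtain ⟨ha, hb, hab, ⟨x, hx, hax, hxb⟩, y, hy, hyab⟩ := h
    by_cases hva : a = v ∨ b = v
    · exact Or.inl ⟨⟨ha, hb, hab, ⟨x, hx, hax, hxb⟩, y, hy, hyab⟩, hva⟩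
    right
    rcases lt_or_ge v a with h1 | h1
    · exact ⟨v, x, ⟨⟨hv, hx, by omega, ⟨a, ha, by omega, by omega⟩, b, hb, by omega⟩,
        Or.inl rfl⟩, Or.inr (by omega)⟩
    rcases lt_or_ge b v with h2 | h2
    · exact ⟨x, v, ⟨⟨hx, hv, by omega, ⟨b, hb, by omega, by omega⟩, a, ha, by omega⟩,
        Or.inr rfl⟩, Or.inl (by omega)⟩
    rcases hyab with h3 | h3
    · exact ⟨y, v, ⟨⟨hy, hv, by omega, ⟨a, ha, by omega, by omega⟩, b, hb, by omega⟩,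
        Or.inr rfl⟩, Or.inr (by omega)⟩
    · exact ⟨v, y, ⟨⟨hv, hy, by omega, ⟨b, hb, by omega, by omega⟩, a, ha, by omega⟩,
        Or.inl rfl⟩, Or.inl (by omega)⟩

theorem Chord.of_erase {S : Finset ℕ} {v a b : ℕ} (h : Chord (S.erase v) a b) : Chord S a b := by
  obtain ⟨ha, hb, hab, ⟨x, hx, hx'⟩, y, hy, hy'⟩ := h
  exact ⟨Finset.mem_of_mem_erase ha, Finset.mem_of_mem_erase hb, hab,
    ⟨x, Finset.mem_of_mem_erase hx, hx'⟩, y, Finset.mem_of_mem_erase hy, hy'⟩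

theorem IsTri.insert_ear {S : Finset ℕ} {T : ℕ → ℕ → Prop} {x v y : ℕ}
    (hx : x ∈ S) (hy : y ∈ S) (hxv : x < v) (hvy : v < y)
    (hpred : ∀ z ∈ S, z < v → z ≤ x) (hsucc : ∀ z ∈ S, v < z → y ≤ z)
    (hxy : Chord S x y) (hT : IsTri (S.erase v) T) :
    IsTri S fun a b => T a b ∨ (a = x ∧ b = y) where
  chord a b h := by
    rcases h with h | ⟨rfl, rfl⟩
    · exact (hT.chord a b h).of_erase
    · exact hxy
  noncross a b c d h h' := by
    have key : ∀ a b, T a b → (a ≤ x ∨ y ≤ a) ∧ (b ≤ x ∨ y ≤ b) := by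
      intro a b hab
      obtain ⟨ha, hb, -⟩ := hT.chord a b hab
      rw [Finset.mem_erase] at ha hb
      have := hpred a ha.2
      have := hsucc a ha.2
      have := hpred b hb.2
      have := hsucc b hb.2
      omega
    rcases h with h | ⟨rfl, rfl⟩ <;> rcases h' with h' | ⟨rfl, rfl⟩
    · exact hT.noncross a b c d h h'
    · have := key _ _ h
      unfold Interleave
      omega
    · have := key _ _ h'
      unfold Interleave
      omega
    · unfold Interleave
      omega
  maximal a b h := by
    obtain ⟨ha, hb, hab, ⟨z, hz, haz, hzb⟩, w, hw, hwab⟩ := h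
    have hxe : x ∈ S.erase v := Finset.mem_erase.2 ⟨by omega, hx⟩
    have hye : y ∈ S.erase v := Finset.mem_erase.2 ⟨by omega, hy⟩
    have h1 := hpred a ha
    have h2 := hsucc a ha
    have h3 := hpred b hb
    have h4 := hsucc b hb
    have h5 := hpred z hz
    have h6 := hsucc z hz
    by_cases hav : a = v
    · exact Or.inr ⟨x, y, Or.inr ⟨rfl, rfl⟩, Or.inr (by omega)⟩
    by_cases hbv : b = v
    · exact Or.inr ⟨x, y, Or.inr ⟨rfl, rfl⟩, Or.inl (by omega)⟩
    by_cases hear : a = x ∧ b = y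
    · exact Or.inl (Or.inr hear)
    have hch : Chord (S.erase v) a b := by
      refine ⟨Finset.mem_erase.2 ⟨hav, ha⟩, Finset.mem_erase.2 ⟨hbv, hb⟩, hab, ?_, ?_⟩
      · by_cases hzv : z = v
        · by_cases hax : a = x
          · exact ⟨y, hye, by omega, by omega⟩
          · exact ⟨x, hxe, by omega, by omega⟩
        · exact ⟨z, Finset.mem_erase.2 ⟨hzv, hz⟩, haz, hzb⟩
      · by_cases hwv : w = v
        · rcases hwab with h | h
          · exact ⟨x, hxe, Or.inl (by omega)⟩
          · exact ⟨y, hye, Or.inr (by omega)⟩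
        · exact ⟨w, Finset.mem_erase.2 ⟨hwv, hw⟩, hwab⟩
    rcases hT.maximal a b hch with h | ⟨c, d, hcd, hX⟩
    · exact Or.inl (Or.inl h)
    · exact Or.inr ⟨c, d, Or.inl hcd, hX⟩

theorem card_le_card_interior (S : Finset ℕ)
    [DecidablePred fun v => (∃ a ∈ S, a < v) ∧ ∃ b ∈ S, v < b] :
    S.card ≤ (S.filter fun v => (∃ a ∈ S, a < v) ∧ ∃ b ∈ S, v < b).card + 2 := by
  rcases S.eq_empty_or_nonempty with rfl | hS
  · simp
  have hsub : S ⊆ (S.filter fun v => (∃ a ∈ S, a < v) ∧ ∃ b ∈ S, v < b) ∪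
      {S.min' hS, S.max' hS} := by
    intro v hv
    have h1 := S.min'_le v hv
    have h2 := S.le_max' v hv
    by_cases h : v = S.min' hS ∨ v = S.max' hS
    · exact Finset.mem_union_right _ (by simpa using h)
    · refine Finset.mem_union_left _ (Finset.mem_filter.2 ⟨hv, ?_, ?_⟩)
      · exact ⟨_, S.min'_mem hS, by omega⟩
      · exact ⟨_, S.max'_mem hS, by omega⟩
  calc S.card ≤ _ := Finset.card_le_card hsub
    _ ≤ _ := Finset.card_union_le _ _
    _ ≤ _ := Nat.add_le_add_left Finset.card_le_two _

/-- Some interior ear of the polygon avoids `R` when `R` has few diagonals. -/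
theorem exists_ear {S : Finset ℕ} {R : ℕ → ℕ → Prop} (hS : 4 ≤ S.card)
    (hR : (chords S R).card + 2 < S.card) :
    ∃ x ∈ S, ∃ v ∈ S, ∃ y ∈ S, x < v ∧ v < y ∧ (∀ z ∈ S, z < v → z ≤ x) ∧
      (∀ z ∈ S, v < z → y ≤ z) ∧ Chord S x y ∧ ¬ R x y := by
  classical
  by_contra! hcon
  have hint := card_le_card_interior S
  set I := S.filter fun v => (∃ a ∈ S, a < v) ∧ ∃ b ∈ S, v < b with hI
  have hex : ∀ v ∈ I, ∃ p : ℕ × ℕ, p ∈ chords S R ∧ p.1 < v ∧ v < p.2 ∧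
      (∀ z ∈ S, z < v → z ≤ p.1) ∧ (∀ z ∈ S, v < z → p.2 ≤ z) := by
    intro v hv
    obtain ⟨hvS, hlo, hhi⟩ := Finset.mem_filter.1 hv
    obtain ⟨x, hx, hxv, hpred⟩ := exists_pred hlo
    obtain ⟨y, hy, hvy, hsucc⟩ := exists_succ hhi
    have hch : Chord S x y := by
      refine ⟨hx, hy, by omega, ⟨v, hvS, hxv, hvy⟩, ?_⟩
      obtain ⟨w, hw, hw'⟩ : ∃ w ∈ S, w ∉ ({x, v, y} : Finset ℕ) := by
        by_contra! hall
        have := (Finset.card_le_card hall).trans Finset.card_le_three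
        omega
      simp only [Finset.mem_insert, Finset.mem_singleton] at hw'
      have := hpred w hw
      have := hsucc w hw
      exact ⟨w, hw, by omega⟩
    exact ⟨(x, y), mem_chords.2 ⟨hch, hcon x hx v hvS y hy hxv hvy hpred hsucc hch⟩,
      hxv, hvy, hpred, hsucc⟩
  choose! f hf hlt hgt hpred hsucc using hex
  have hle : I.card ≤ (chords S R).card := by
    refine Finset.card_le_card_of_injOn f (fun v hv => hf v hv) fun v hv w hw hvw => ?_
    have h1 := hlt v hv
    have h2 := hgt v hv
    have h3 := hpred w hw v (Finset.mem_filter.1 hv).1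
    have h4 := hsucc w hw v (Finset.mem_filter.1 hv).1
    rw [← hvw] at h3 h4
    omega
  omega

/-- A relation with fewer than `|S| - 2` diagonals misses some triangulation of `S`. -/
theorem exists_isTri_avoiding (R : ℕ → ℕ → Prop) (S : Finset ℕ) (hS : 3 ≤ S.card)
    (hR : (chords S R).card + 2 < S.card) :
    ∃ T, IsTri S T ∧ ∀ a b, T a b → ¬ R a b := by
  induction hk : S.card generalizing S with
  | zero => omega
  | succ k ih =>
    by_cases hfan : ∃ v ∈ S, ∀ a b, Chord S a b → (a = v ∨ b = v) → ¬ R a b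
    · obtain ⟨v, hv, hfan⟩ := hfan
      exact ⟨_, IsTri.fan hv, fun a b h => hfan a b h.1 h.2⟩
    push Not at hfan
    have h4 : 4 ≤ S.card := by
      obtain ⟨v, hv⟩ := Finset.card_pos.1 (by omega : 0 < S.card)
      obtain ⟨a, b, ⟨ha, hb, hab, ⟨x, hx, hax, hxb⟩, y, hy, hyab⟩, -⟩ := hfan v hv
      have hsub : ({a, b, x, y} : Finset ℕ) ⊆ S := by
        intro z hz
        simp only [Finset.mem_insert, Finset.mem_singleton] at hz
        rcases hz with rfl | rfl | rfl | rfl <;> assumption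
      have hcard : ({a, b, x, y} : Finset ℕ).card = 4 := by
        repeat rw [Finset.card_insert_of_notMem]
        · simp
        all_goals simp only [Finset.mem_insert, Finset.mem_singleton]; omega
      rw [← hcard]
      exact Finset.card_le_card hsub
    obtain ⟨x, hx, v, hv, y, hy, hxv, hvy, hpred, hsucc, hch, hxy⟩ := exists_ear h4 hR
    have hce := Finset.card_erase_of_mem hv
    have hlt : (chords (S.erase v) R).card < (chords S R).card := by
      refine Finset.card_lt_card (Finset.ssubset_iff_subset_ne.2 ⟨fun p hp => ?_, fun heq => ?_⟩)
      · rw [mem_chords] at hp ⊢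
        exact ⟨hp.1.of_erase, hp.2⟩
      · obtain ⟨a, b, hab, hav, hRab⟩ := hfan v hv
        have hmem : (a, b) ∈ chords (S.erase v) R := heq ▸ mem_chords.2 ⟨hab, hRab⟩
        have hch' := (mem_chords.1 hmem).1
        rcases hav with rfl | rfl
        · exact Finset.notMem_erase _ _ hch'.1
        · exact Finset.notMem_erase _ _ hch'.2.1
    obtain ⟨T, hT, hTR⟩ := ih (S.erase v) (by omega) (by omega) (by omega)
    refine ⟨_, hT.insert_ear hx hy hxv hvy hpred hsucc hch, fun a b h => ?_⟩
    rcases h with h | ⟨rfl, rfl⟩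
    · exact hTR a b h
    · exact hxy

theorem chord_range {n a b : ℕ} :
    Chord (Finset.range n) a b ↔ a + 2 ≤ b ∧ b < n ∧ (a ≠ 0 ∨ b + 1 ≠ n) := by
  simp only [Chord, Finset.mem_range]
  constructor
  · rintro ⟨_, hb, _, ⟨x, _, _, _⟩, y, _, _⟩
    omega
  · rintro ⟨h1, h2, h3⟩
    refine ⟨by omega, h2, by omega, ⟨a + 1, by omega, by omega, by omega⟩, ?_⟩
    rcases Nat.eq_zero_or_pos a with h | h
    · exact ⟨b + 1, by omega, by omega⟩
    · exact ⟨0, by omega, by omega⟩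

/-- The triangulation with hubs `0` and `i` around the triangle `0, i, q`, where `i < q`. -/
theorem isTri_hubs_up {n i q : ℕ} (hi : 1 ≤ i) (hiq : i + 2 ≤ q) (hq : q < n) :
    IsTri (Finset.range n) fun a b => Chord (Finset.range n) a b ∧
      ((a = 0 ∧ (b ≤ i ∨ q ≤ b)) ∨ (a = i ∧ b ≤ q)) where
  chord _ _ h := h.1
  noncross a b c d h h' := by
    simp only [chord_range] at h h'
    unfold Interleave
    omega
  maximal a b h := by
    simp only [chord_range] at h ⊢
    unfold Interleave
    by_cases hT : (a = 0 ∧ (b ≤ i ∨ q ≤ b)) ∨ (a = i ∧ b ≤ q)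
    · exact Or.inl ⟨h, hT⟩
    right
    by_cases h1 : a = 0
    · exact ⟨i, q, by omega, by omega⟩
    by_cases h2 : a + 1 ≤ i ∧ i < b
    · exact ⟨0, i, by omega, by omega⟩
    by_cases h3 : a < q ∧ q < b
    · exact ⟨0, q, by omega, by omega⟩
    by_cases h4 : i < a ∧ b ≤ q
    · exact ⟨i, a + 1, by omega, by omega⟩
    · exact ⟨0, a + 1, by omega, by omega⟩

/-- The triangulation with hubs `0` and `i` around the triangle `0, c, i`, where `c < i`. -/
theorem isTri_hubs_down {n i c : ℕ} (hc : 1 ≤ c) (hci : c + 2 ≤ i) (hi : i < n) :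
    IsTri (Finset.range n) fun a b => Chord (Finset.range n) a b ∧
      ((a = 0 ∧ (b ≤ c ∨ i ≤ b)) ∨ (b = i ∧ c ≤ a)) where
  chord _ _ h := h.1
  noncross a b c d h h' := by
    simp only [chord_range] at h h'
    unfold Interleave
    omega
  maximal a b h := by
    simp only [chord_range] at h ⊢
    unfold Interleave
    by_cases hT : (a = 0 ∧ (b ≤ c ∨ i ≤ b)) ∨ (b = i ∧ c ≤ a)
    · exact Or.inl ⟨h, hT⟩
    right
    by_cases h1 : a = 0
    · exact ⟨c, i, by omega, by omega⟩
    by_cases h2 : a < c ∧ c < b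
    · exact ⟨0, c, by omega, by omega⟩
    by_cases h3 : a < i ∧ i < b
    · exact ⟨0, i, by omega, by omega⟩
    by_cases h4 : c ≤ a ∧ b < i
    · exact ⟨b - 1, i, by omega, by omega⟩
    · exact ⟨0, a + 1, by omega, by omega⟩

/-- A small blocking set of the polygon on `0, …, n - 1`, seen as a relation on labels. -/
structure IsSmallBlocking (n : ℕ) (R : ℕ → ℕ → Prop) : Prop where
  chord : ∀ a b, a < b → b < n → R a b → Chord (Finset.range n) a b
  card_le : (chords (Finset.range n) R).card + 2 ≤ n
  blocks : ∀ T, IsTri (Finset.range n) T → ∃ a b, T a b ∧ R a b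

namespace IsSmallBlocking

variable {n : ℕ} {R : ℕ → ℕ → Prop}

theorem exists_zero (h : IsSmallBlocking n R) (hn : 4 ≤ n) :
    ∃ p, 2 ≤ p ∧ p + 2 ≤ n ∧ R 0 p := by
  obtain ⟨a, b, ⟨hab, hv⟩, hR⟩ :=
    h.blocks _ (IsTri.fan (v := 0) (Finset.mem_range.2 (by omega)))
  rw [chord_range] at hab
  obtain rfl : a = 0 := by omega
  exact ⟨b, by omega, by omega, hR⟩

/-- A vertex whose ear-cover is not in the blocking set has degree at most one. -/
theorem zero_unique (h : IsSmallBlocking n R) (hn : 4 ≤ n) (hfree : ¬ R 1 (n - 1))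
    {p q : ℕ} (hp : 0 < p) (hpn : p < n) (hq : 0 < q) (hqn : q < n)
    (hRp : R 0 p) (hRq : R 0 q) : p = q := by
  classical
  by_contra hpq
  set S := Finset.Icc 1 (n - 1) with hS
  have hScard : S.card = n - 1 := by simp [hS]
  have hchS : ∀ a b, Chord S a b ↔ Chord (Finset.range n) a b ∧ 1 ≤ a ∧ (a ≠ 1 ∨ b + 1 ≠ n) := by
    intro a b
    rw [chord_range]
    simp only [Chord, hS, Finset.mem_Icc]
    constructor
    · rintro ⟨_, _, _, ⟨x, _, _⟩, y, _, _⟩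
      omega
    · intro h
      refine ⟨by omega, by omega, by omega, ⟨a + 1, by omega, by omega⟩, ?_⟩
      by_cases ha : a = 1
      · exact ⟨b + 1, by omega, by omega⟩
      · exact ⟨1, by omega, by omega⟩
  have hsub : insert (0, p) (insert (0, q) (chords S R)) ⊆ chords (Finset.range n) R := by
    intro e he
    simp only [Finset.mem_insert] at he
    rcases he with rfl | rfl | he
    · exact mem_chords.2 ⟨h.chord 0 p hp hpn hRp, hRp⟩
    · exact mem_chords.2 ⟨h.chord 0 q hq hqn hRq, hRq⟩
    · rw [mem_chords, hchS] at he
      exact mem_chords.2 ⟨he.1.1, he.2⟩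
  have hzero : ∀ r, (0, r) ∉ chords S R := by
    intro r hr
    rw [mem_chords, hchS] at hr
    omega
  have hcard := Finset.card_le_card hsub
  rw [Finset.card_insert_of_notMem (by simp [hpq, hzero]),
    Finset.card_insert_of_notMem (hzero q)] at hcard
  have := h.card_le
  obtain ⟨T, hT, hTR⟩ := exists_isTri_avoiding R S (by omega) (by omega)
  have htri : IsTri (Finset.range n) fun a b => T a b ∨ (a = 1 ∧ b = n - 1) := by
    refine ⟨fun a b hab => ?_, fun a b c d hab hcd => ?_, fun a b hab => ?_⟩
    · rcases hab with hab | ⟨rfl, rfl⟩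
      · exact ((hchS a b).1 (hT.chord a b hab)).1
      · rw [chord_range]
        omega
    · rcases hab with hab | ⟨rfl, rfl⟩ <;> rcases hcd with hcd | ⟨rfl, rfl⟩
      · exact hT.noncross a b c d hab hcd
      · have := hT.chord a b hab
        rw [hchS, chord_range] at this
        unfold Interleave
        omega
      · have := hT.chord c d hcd
        rw [hchS, chord_range] at this
        unfold Interleave
        omega
      · unfold Interleave
        omega
    · by_cases hear : a = 1 ∧ b = n - 1
      · exact Or.inl (Or.inr hear)
      by_cases ha : a = 0
      · rw [chord_range] at hab
        exact Or.inr ⟨1, n - 1, Or.inr ⟨rfl, rfl⟩, Or.inl (by omega)⟩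
      · rcases hT.maximal a b ((hchS a b).2 ⟨hab, by omega, by omega⟩) with h | ⟨c, d, hcd, hX⟩
        · exact Or.inl (Or.inl h)
        · exact Or.inr ⟨c, d, Or.inl hcd, hX⟩
  obtain ⟨a, b, hab, hR⟩ := h.blocks _ htri
  rcases hab with hab | ⟨rfl, rfl⟩
  · exact hTR a b hab hR
  · exact hfree hR

/-- If the vertex `0` has degree at most one, the whole blocking set is determined by the
unique edge `{0, p}` and by one edge for each of the other vertices. -/
theorem exists_structure (h : IsSmallBlocking n R) {p : ℕ} (hp : 2 ≤ p) (hpn : p + 2 ≤ n)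
    (hRp : R 0 p) (huniq : ∀ q, 0 < q → q < n → R 0 q → q = p) :
    ∃ up dn : ℕ → ℕ,
      (∀ i, 1 ≤ i → i < p → R i (up i) ∧ i + 2 ≤ up i ∧ up i ≤ p + 1) ∧
      (∀ i, p < i → i < n → R (dn i) i ∧ p ≤ dn i + 1 ∧ dn i + 2 ≤ i) ∧
      ∀ a b, a < b → b < n → R a b →
        (a = 0 ∧ b = p) ∨ (1 ≤ a ∧ a < p ∧ b = up a) ∨ (p + 2 ≤ b ∧ a = dn b) := by
  classical
  have hup : ∀ i, 1 ≤ i ∧ i < p → ∃ j, R i j ∧ i + 2 ≤ j ∧ j ≤ p + 1 := by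
    rintro i ⟨hi, hip⟩
    obtain ⟨a, b, ⟨hab, hv⟩, hR⟩ :=
      h.blocks _ (isTri_hubs_up (n := n) hi (q := p + 1) (by omega) (by omega))
    rw [chord_range] at hab
    rcases hv with ⟨rfl, hb⟩ | ⟨rfl, hb⟩
    · have := huniq b (by omega) (by omega) hR
      omega
    · exact ⟨b, hR, by omega, hb⟩
  have hdn : ∀ i, p < i ∧ i < n → ∃ j, R j i ∧ p ≤ j + 1 ∧ j + 2 ≤ i := by
    rintro i ⟨hi, hin⟩
    obtain ⟨a, b, ⟨hab, hv⟩, hR⟩ :=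
      h.blocks _ (isTri_hubs_down (n := n) (c := p - 1) (by omega) (by omega) hin)
    rw [chord_range] at hab
    rcases hv with ⟨rfl, hb⟩ | ⟨rfl, hb⟩
    · have := huniq b (by omega) (by omega) hR
      omega
    · exact ⟨a, hR, by omega, by omega⟩
  choose! up hup using hup
  choose! dn hdn using hdn
  refine ⟨up, dn, fun i h1 h2 => hup i ⟨h1, h2⟩, fun i h1 h2 => hdn i ⟨h1, h2⟩, ?_⟩
  set U := (Finset.Ico 1 p).image fun i => (i, up i) with hU
  set D := (Finset.Ico (p + 2) n).image fun i => (dn i, i) with hD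
  have hUc : U.card = p - 1 := by
    rw [hU, Finset.card_image_of_injective _ fun i j hij => (Prod.ext_iff.1 hij).1, Nat.card_Ico]
  have hDc : D.card = n - (p + 2) := by
    rw [hD, Finset.card_image_of_injective _ fun i j hij => (Prod.ext_iff.1 hij).2, Nat.card_Ico]
  have hdisj : Disjoint U D := by
    rw [Finset.disjoint_left]
    intro e heU heD
    simp only [hU, hD, Finset.mem_image, Finset.mem_Ico] at heU heD
    obtain ⟨i, hi, rfl⟩ := heU
    obtain ⟨j, hj, hij⟩ := heD
    have := (hup i hi).2.2
    have := (Prod.ext_iff.1 hij).2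
    simp only at this
    omega
  have hnot : (0, p) ∉ U ∪ D := by
    simp only [hU, hD, Finset.mem_union, Finset.mem_image, Finset.mem_Ico, Prod.ext_iff]
    rintro (⟨i, _, _⟩ | ⟨i, _, _⟩) <;> omega
  have hsub : insert (0, p) (U ∪ D) ⊆ chords (Finset.range n) R := by
    intro e he
    simp only [Finset.mem_insert, Finset.mem_union, hU, hD, Finset.mem_image,
      Finset.mem_Ico] at he
    rcases he with rfl | ⟨i, hi, rfl⟩ | ⟨i, hi, rfl⟩
    · exact mem_chords.2 ⟨h.chord 0 p (by omega) (by omega) hRp, hRp⟩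
    · have := hup i hi
      exact mem_chords.2 ⟨h.chord _ _ (by omega) (by omega) this.1, this.1⟩
    · have := hdn i ⟨by omega, by omega⟩
      exact mem_chords.2 ⟨h.chord _ _ (by omega) (by omega) this.1, this.1⟩
  have hcard : (insert (0, p) (U ∪ D)).card = n - 2 := by
    rw [Finset.card_insert_of_notMem hnot, Finset.card_union_of_disjoint hdisj, hUc, hDc]
    omega
  have hle := h.card_le
  have heq := Finset.eq_of_subset_of_card_le hsub (by omega)
  intro a b hab hb hR
  have hmem : (a, b) ∈ insert (0, p) (U ∪ D) := heq ▸ mem_chords.2 ⟨h.chord a b hab hb hR, hR⟩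
  simp only [Finset.mem_insert, Finset.mem_union, hU, hD, Finset.mem_image,
    Finset.mem_Ico, Prod.ext_iff] at hmem
  rcases hmem with hm | ⟨i, hi, rfl, rfl⟩ | ⟨i, hi, rfl, rfl⟩
  · exact Or.inl hm
  · exact Or.inr (Or.inl ⟨hi.1, hi.2, rfl⟩)
  · exact Or.inr (Or.inr ⟨hi.1, rfl⟩)

/-- In a polygon with at least five vertices, some ear-cover is missing. -/
theorem exists_free (h : IsSmallBlocking n R) (hn : 5 ≤ n) :
    ¬ ((∀ i, i + 2 < n → R i (i + 2)) ∧ R 0 (n - 2)) := by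
  classical
  rintro ⟨hR, hR0⟩
  set U := (Finset.range (n - 2)).image fun i => (i, i + 2) with hU
  have hUc : U.card = n - 2 := by
    rw [hU, Finset.card_image_of_injective _ fun i j hij => (Prod.ext_iff.1 hij).1,
      Finset.card_range]
  have hnot : (0, n - 2) ∉ U := by
    simp only [hU, Finset.mem_image, Prod.ext_iff]
    rintro ⟨i, _, _⟩
    omega
  have hsub : insert (0, n - 2) U ⊆ chords (Finset.range n) R := by
    intro e he
    simp only [Finset.mem_insert, hU, Finset.mem_image, Finset.mem_range] at he
    rcases he with rfl | ⟨i, hi, rfl⟩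
    · exact mem_chords.2 ⟨h.chord _ _ (by omega) (by omega) hR0, hR0⟩
    · have := hR i (by omega)
      exact mem_chords.2 ⟨h.chord _ _ (by omega) (by omega) this, this⟩
  have hcard := Finset.card_le_card hsub
  rw [Finset.card_insert_of_notMem hnot] at hcard
  have := h.card_le
  omega

end IsSmallBlocking

/-- The structure of a blocking relation seen from a vertex `v + 1` whose ear-cover is missing. -/
theorem exists_structure_of_free {n : ℕ} {R : ℕ → ℕ → Prop} (hn : 4 ≤ n)
    (hper : ∀ i k, R i (k + n) ↔ R i k) (hsymm : ∀ i k, R i k → R k i)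
    (hB : ∀ J, IsSmallBlocking n fun i k => R (J + i) (J + k)) {v : ℕ} (hv : ¬ R v (v + 2)) :
    ∃ (p : ℕ) (up dn : ℕ → ℕ), 2 ≤ p ∧ p + 2 ≤ n ∧
      (∀ q, 0 < q → q < n → R (v + 1) (v + 1 + q) → q = p) ∧
      (∀ i, 1 ≤ i → i < p → R (v + 1 + i) (v + 1 + up i) ∧ i + 2 ≤ up i ∧ up i ≤ p + 1) ∧
      (∀ i, p < i → i < n → R (v + 1 + dn i) (v + 1 + i) ∧ p ≤ dn i + 1 ∧ dn i + 2 ≤ i) ∧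
      ∀ a b, a < b → b < n → R (v + 1 + a) (v + 1 + b) →
        (a = 0 ∧ b = p) ∨ (1 ≤ a ∧ a < p ∧ b = up a) ∨ (p + 2 ≤ b ∧ a = dn b) := by
  have h := hB (v + 1)
  obtain ⟨p, hp, hpn, hRp⟩ := h.exists_zero hn
  have hfree : ¬ R (v + 1 + 1) (v + 1 + (n - 1)) := by
    rw [show v + 1 + (n - 1) = v + n by omega, hper]
    exact fun h' => hv (hsymm _ _ h')
  have huniq : ∀ q, 0 < q → q < n → R (v + 1) (v + 1 + q) → q = p := fun q hq hqn hR =>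
    h.zero_unique hn hfree hq hqn (by omega) (by omega) hR hRp
  obtain ⟨up, dn, hup, hdn, htri⟩ := h.exists_structure hp hpn hRp huniq
  exact ⟨p, up, dn, hp, hpn, huniq, hup, hdn, htri⟩

/-- A vertex with missing ear-cover followed by one with present ear-cover. -/
theorem exists_boundary {n : ℕ} {R : ℕ → ℕ → Prop} (hn : 5 ≤ n)
    (hper : ∀ i k, R i (k + n) ↔ R i k) (hsymm : ∀ i k, R i k → R k i)
    (hB : ∀ J, IsSmallBlocking n fun i k => R (J + i) (J + k)) :
    ∃ v, ¬ R v (v + 2) ∧ R (v + 1) (v + 1 + 2) := by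
  obtain ⟨v₀, hv₀⟩ : ∃ v, ¬ R v (v + 2) := by
    by_contra! hall
    refine (hB 0).exists_free hn ⟨fun i _ => ?_, ?_⟩
    · simpa using hall i
    · have := hall (n - 2)
      rw [show n - 2 + 2 = 0 + n by omega, hper] at this
      simpa using hsymm _ _ this
  by_contra! hcon
  have hnone : ∀ k, ¬ R (v₀ + k) (v₀ + k + 2) := by
    intro k
    induction k with
    | zero => exact hv₀
    | succ k ih => exact hcon _ ih
  obtain ⟨p, up, -, hp, -, -, hup, -⟩ :=
    exists_structure_of_free (by omega) hper hsymm hB hv₀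
  obtain ⟨h1, h2, h3⟩ := hup (p - 1) (by omega) (by omega)
  apply hnone p
  rwa [show v₀ + 1 + (p - 1) = v₀ + p by omega,
    show v₀ + 1 + up (p - 1) = v₀ + p + 2 by omega] at h1

/-- A small blocking relation consists of a net of ear-covers together with beams. -/
theorem exists_net_of_five_le {n : ℕ} {R : ℕ → ℕ → Prop} (hn : 5 ≤ n)
    (hper : ∀ i k, R i (k + n) ↔ R i k) (hsymm : ∀ i k, R i k → R k i)
    (hB : ∀ J, IsSmallBlocking n fun i k => R (J + i) (J + k)) :
    ∃ (a m : ℕ) (idx : ℕ → ℕ), 1 ≤ m ∧ m + 3 ≤ n ∧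
      (∀ j, 1 ≤ j → m + 2 + j < n → 1 ≤ idx j ∧ idx j ≤ m + 1) ∧
      (∀ t ≤ m, R (a + t) (a + (t + 2))) ∧
      (∀ j, 1 ≤ j → m + 2 + j < n → R (a + idx j) (a + (m + 2 + j))) ∧
      (∀ x y, x < y → y < n → R (a + x) (a + y) → (x ≤ m ∧ y = x + 2) ∨
        ∃ j, 1 ≤ j ∧ m + 2 + j < n ∧ y = m + 2 + j ∧ x = idx j) ∧
      ∀ j k, 1 ≤ j → j < k → m + 2 + k < n → ¬ idx j + 2 ≤ idx k := by
  classical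
  obtain ⟨v, hv, hcov⟩ := exists_boundary hn hper hsymm hB
  obtain ⟨p, up, dn, hp, hpn, huniq, hup, hdn, htri⟩ :=
    exists_structure_of_free (by omega) hper hsymm hB hv
  obtain rfl : 2 = p := huniq 2 (by omega) (by omega) hcov
  set a := v + 1
  have h13 : R (a + 1) (a + 3) := by
    obtain ⟨h1, h2, h3⟩ := hup 1 le_rfl (by omega)
    rwa [show up 1 = 3 by omega] at h1
  have hup1 : up 1 = 3 := by
    have := hup 1 le_rfl (by omega)
    omega
  set P : ℕ → Prop := fun t => R (a + t) (a + (t + 2)) with hP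
  set m := Nat.findGreatest P (n - 3)
  have hm1 : 1 ≤ m := Nat.le_findGreatest (by omega) h13
  have hmn : m ≤ n - 3 := Nat.findGreatest_le _
  have hPm : P m := Nat.findGreatest_spec (P := P) (by omega : 1 ≤ n - 3) h13
  have hPgt : ∀ t, t ≤ n - 3 → P t → t ≤ m := fun t ht hPt => Nat.le_findGreatest ht hPt
  have hstep : ∀ t, t + 3 < n → P (t + 1) → P t := by
    intro t ht hPt
    rcases (by omega : t = 0 ∨ t = 1 ∨ 2 ≤ t) with rfl | rfl | ht2
    · exact hcov
    · exact h13
    by_contra hPn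
    have hPn' : ¬ R (a + t) (a + t + 2) := hPn
    obtain ⟨p, -, -, -, -, huniq', -⟩ :=
      exists_structure_of_free (by omega) hper hsymm hB hPn'
    obtain ⟨h1, h2, h3⟩ := hdn (t + 1) (by omega) (by omega)
    have e1 := huniq' 2 (by omega) (by omega) hPt
    have e2 := huniq' (dn (t + 1) + n - (t + 1)) (by omega) (by omega) (by
      rw [show a + t + 1 + (dn (t + 1) + n - (t + 1)) = a + dn (t + 1) + n by omega, hper]
      exact hsymm _ _ h1)
    omega
  have hnet : ∀ t ≤ m, P t := fun t ht =>
    Nat.decreasingInduction' (P := P) (fun k hk _ hPk => hstep k (by omega) hPk) ht hPm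
  have hfree : ∀ t, m < t → t + 1 < n → ¬ R (a + t) (a + t + 2) := by
    intro t hmt htn hR
    by_cases ht : t ≤ n - 3
    · have := hPgt t ht hR
      omega
    · rw [show a + t + 2 = a + n by omega, hper, show t = n - 2 by omega] at hR
      have := htri 0 (n - 2) (by omega) (by omega) (hsymm _ _ hR)
      have := hdn (n - 2) (by omega) (by omega)
      omega
  have hdnlt : ∀ V, m + 3 ≤ V → V < n → dn V ≤ m + 1 := by
    intro V hmV hVn
    obtain ⟨p, up', -, hp, -, huniq', hup', -⟩ :=
      exists_structure_of_free (by omega) hper hsymm hB (hfree (V - 1) (by omega) (by omega))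
    obtain ⟨h1, h2, h3⟩ := hdn V (by omega) hVn
    have e2 := huniq' (dn V + n - V) (by omega) (by omega) (by
      rw [show a + (V - 1) + 1 + (dn V + n - V) = a + dn V + n by omega, hper,
        show a + (V - 1) + 1 = a + V by omega]
      exact hsymm _ _ h1)
    obtain ⟨h4, h5, h6⟩ := hup' (p - 1) (by omega) (by omega)
    rw [show a + (V - 1) + 1 + (p - 1) = a + (dn V - 1) + n by omega,
      show a + (V - 1) + 1 + up' (p - 1) = a + (dn V - 1 + 2) + n by omega, hper] at h4
    have := hPgt (dn V - 1) (by omega) (hsymm _ _ ((hper _ _).1 (hsymm _ _ h4)))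
    omega
  refine ⟨a, m, fun j => dn (m + 2 + j), hm1, by omega, ?_, hnet, ?_, ?_, ?_⟩
  · intro j hj hjn
    have := hdn (m + 2 + j) (by omega) hjn
    have := hdnlt (m + 2 + j) (by omega) hjn
    show 1 ≤ dn (m + 2 + j) ∧ dn (m + 2 + j) ≤ m + 1
    omega
  · intro j hj hjn
    exact (hdn (m + 2 + j) (by omega) hjn).1
  · intro x y hxy hyn hR
    rcases htri x y hxy hyn hR with ⟨rfl, rfl⟩ | ⟨h1, h2, h3⟩ | ⟨h1, h2⟩
    · exact Or.inl ⟨by omega, by omega⟩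
    · obtain rfl : x = 1 := by omega
      exact Or.inl ⟨by omega, by omega⟩
    · by_cases hym : y ≤ m + 2
      · have hy := hnet (y - 2) (by omega)
        have hy' : R (a + (y - 2)) (a + y) := by
          have : y - 2 + 2 = y := by omega
          simpa only [hP, this] using hy
        have := htri (y - 2) y (by omega) hyn hy'
        exact Or.inl (by omega)
      · refine Or.inr ⟨y - (m + 2), by omega, by omega, by omega, ?_⟩
        show x = dn (m + 2 + (y - (m + 2)))
        rw [show m + 2 + (y - (m + 2)) = y by omega]
        exact h2
  · intro j k hj hjk hkn hidx
    simp only at hidx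
    obtain ⟨p, up', dn', hp, -, huniq', hup', hdn', htri'⟩ :=
      exists_structure_of_free (by omega) hper hsymm hB
        (hfree (m + 2 + j - 1) (by omega) (by omega))
    obtain ⟨h1, h2, h3⟩ := hdn (m + 2 + j) (by omega) (by omega)
    obtain ⟨h4, h5, h6⟩ := hdn (m + 2 + k) (by omega) (by omega)
    have h7 := hdnlt (m + 2 + k) (by omega) (by omega)
    have hJ : a + (m + 2 + j - 1) + 1 = a + (m + 2 + j) := by omega
    rw [hJ] at huniq' hup' hdn' htri'
    have e2 := huniq' (dn (m + 2 + j) + n - (m + 2 + j)) (by omega) (by omega) (by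
      rw [show a + (m + 2 + j) + (dn (m + 2 + j) + n - (m + 2 + j)) = a + dn (m + 2 + j) + n
        by omega, hper]
      exact hsymm _ _ h1)
    have hch := htri' (k - j) (dn (m + 2 + k) + n - (m + 2 + j)) (by omega) (by omega) (by
      rw [show a + (m + 2 + j) + (dn (m + 2 + k) + n - (m + 2 + j)) = a + dn (m + 2 + k) + n
        by omega, hper, show a + (m + 2 + j) + (k - j) = a + (m + 2 + k) by omega]
      exact hsymm _ _ h4)
    have := hup' (k - j)
    have := hdn' (dn (m + 2 + k) + n - (m + 2 + j))
    omega

theorem exists_net {n : ℕ} {R : ℕ → ℕ → Prop} (hn : 4 ≤ n)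
    (hper : ∀ i k, R i (k + n) ↔ R i k) (hsymm : ∀ i k, R i k → R k i)
    (hB : ∀ J, IsSmallBlocking n fun i k => R (J + i) (J + k)) :
    ∃ (a m : ℕ) (idx : ℕ → ℕ), 1 ≤ m ∧ m + 3 ≤ n ∧
      (∀ j, 1 ≤ j → m + 2 + j < n → 1 ≤ idx j ∧ idx j ≤ m + 1) ∧
      (∀ t ≤ m, R (a + t) (a + (t + 2))) ∧
      (∀ j, 1 ≤ j → m + 2 + j < n → R (a + idx j) (a + (m + 2 + j))) ∧
      (∀ x y, x < y → y < n → R (a + x) (a + y) → (x ≤ m ∧ y = x + 2) ∨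
        ∃ j, 1 ≤ j ∧ m + 2 + j < n ∧ y = m + 2 + j ∧ x = idx j) ∧
      ∀ j k, 1 ≤ j → j < k → m + 2 + k < n → ¬ idx j + 2 ≤ idx k := by
  rcases hn.lt_or_eq with hn5 | rfl
  · exact exists_net_of_five_le hn5 hper hsymm hB
  have hzero : ∀ J, R J (J + 2) := by
    intro J
    obtain ⟨p, hp, hp4, hR⟩ := (hB J).exists_zero hn
    obtain rfl : p = 2 := by omega
    exact hR
  refine ⟨0, 1, id, le_rfl, le_rfl, fun j _ _ => by omega, fun t _ => ?_,
    fun j _ _ => by omega, fun x y hxy hy hR => Or.inl ?_, fun j k _ _ _ => by omega⟩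
  · simpa using hzero t
  · have := (hB 0).chord x y hxy hy hR
    rw [chord_range] at this
    omega

theorem val_sub_label {n : ℕ} [NeZero n] (u : ZMod n) {a b : ℕ} (ha : a < n) (hb : b < n) :
    ((u + (b : ZMod n)) - (u + (a : ZMod n))).val = if a ≤ b then b - a else n + b - a := by
  rw [add_sub_add_left_eq_sub]
  split_ifs with h
  · rw [← Nat.cast_sub h, ZMod.val_cast_of_lt (by omega)]
  · have : (b : ZMod n) - (a : ZMod n) = ((n + b - a : ℕ) : ZMod n) := by
      rw [Nat.cast_sub (by omega)]
      simp
    rw [this, ZMod.val_cast_of_lt (by omega)]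

theorem exists_label {n : ℕ} [NeZero n] (u v : ZMod n) : ∃ a < n, v = u + (a : ZMod n) :=
  ⟨(v - u).val, ZMod.val_lt _, by simp⟩

theorem label_inj {n : ℕ} [NeZero n] (u : ZMod n) {a b : ℕ} (ha : a < n) (hb : b < n)
    (h : u + (a : ZMod n) = u + (b : ZMod n)) : a = b := by
  have h1 := val_sub_label u ha hb
  rw [h, sub_self, ZMod.val_zero] at h1
  split_ifs at h1 <;> omega

theorem btw_label {n : ℕ} [NeZero n] (u : ZMod n) {a x b : ℕ} (ha : a < n) (hx : x < n)
    (hb : b < n) : Btw (u + (a : ZMod n)) (u + (x : ZMod n)) (u + (b : ZMod n)) ↔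
      (a < x ∧ x < b) ∨ (x < b ∧ b < a) ∨ (b < a ∧ a < x) := by
  rw [Btw, val_sub_label u ha hx, val_sub_label u ha hb]
  split_ifs <;> omega

theorem crosses_label {n : ℕ} [NeZero n] (u : ZMod n) {a b c d : ℕ} (hab : a < b) (hb : b < n)
    (hcd : c < d) (hd : d < n) :
    Crosses s(u + (a : ZMod n), u + (b : ZMod n)) s(u + (c : ZMod n), u + (d : ZMod n)) ↔
      Interleave a b c d := by
  have ha : a < n := by omega
  have hc : c < n := by omega
  constructor
  · rintro ⟨a', b', c', d', h1, h2, h3, h4⟩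
    unfold Interleave
    rcases Sym2.eq_iff.1 h1 with ⟨rfl, rfl⟩ | ⟨rfl, rfl⟩ <;>
      rcases Sym2.eq_iff.1 h2 with ⟨rfl, rfl⟩ | ⟨rfl, rfl⟩ <;>
      rw [btw_label u (by assumption) (by assumption) (by assumption)] at h3 h4 <;> omega
  · rintro (h | h)
    · exact ⟨_, _, _, _, rfl, rfl, (btw_label u ha hc hb).2 (by omega),
        (btw_label u hb hd ha).2 (by omega)⟩
    · exact ⟨_, _, _, _, rfl, Sym2.eq_swap, (btw_label u ha hd hb).2 (by omega),
        (btw_label u hb hc ha).2 (by omega)⟩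

theorem isDiagonal_label {n : ℕ} [NeZero n] (u : ZMod n) {a b : ℕ} (hab : a < b) (hb : b < n) :
    IsDiagonal s(u + (a : ZMod n), u + (b : ZMod n)) ↔ Chord (Finset.range n) a b := by
  have ha : a < n := by omega
  have key : 2 ≤ cyclicDist (u + (a : ZMod n)) (u + (b : ZMod n)) ↔
      Chord (Finset.range n) a b := by
    rw [chord_range, cyclicDist, val_sub_label u ha hb, val_sub_label u hb ha]
    split_ifs <;> omega
  rw [← key]
  constructor
  · rintro ⟨i, j, h, hij⟩
    rcases Sym2.eq_iff.1 h with ⟨rfl, rfl⟩ | ⟨rfl, rfl⟩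
    · exact hij
    · rwa [cyclicDist, min_comm]
  · exact fun h => ⟨_, _, rfl, h⟩

theorem IsDiagonal.exists_label {n : ℕ} [NeZero n] (u : ZMod n) {e : Sym2 (ZMod n)}
    (he : IsDiagonal e) :
    ∃ a b : ℕ, a < b ∧ b < n ∧ e = s(u + (a : ZMod n), u + (b : ZMod n)) := by
  obtain ⟨i, j, rfl, hij⟩ := he
  obtain ⟨a, ha, rfl⟩ := ConvexBlockers.exists_label u i
  obtain ⟨b, hb, rfl⟩ := ConvexBlockers.exists_label u j
  rcases lt_trichotomy a b with h | rfl | h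
  · exact ⟨a, b, h, hb, rfl⟩
  · simp [cyclicDist] at hij
  · exact ⟨b, a, h, ha, Sym2.eq_swap⟩

/-- Every triangulation of the labels `0, …, n - 1` gives a triangulation of the polygon. -/
theorem IsTri.isTriangulation {n : ℕ} [NeZero n] (u : ZMod n) {T : ℕ → ℕ → Prop}
    (hT : IsTri (Finset.range n) T) :
    IsTriangulation {e | ∃ a b : ℕ, T a b ∧ e = s(u + (a : ZMod n), u + (b : ZMod n))} := by
  have hlt : ∀ a b, T a b → a < b ∧ b < n := by
    intro a b h
    have := hT.chord a b h
    rw [chord_range] at this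
    omega
  refine ⟨?_, ?_, ?_⟩
  · rintro _ ⟨a, b, h, rfl⟩
    exact (isDiagonal_label u (hlt a b h).1 (hlt a b h).2).2 (hT.chord a b h)
  · rintro _ ⟨a, b, h, rfl⟩ _ ⟨c, d, h', rfl⟩ hX
    rw [crosses_label u (hlt a b h).1 (hlt a b h).2 (hlt c d h').1 (hlt c d h').2] at hX
    exact hT.noncross a b c d h h' hX
  · intro T' hdiag hnc hsub
    refine Set.Subset.antisymm (fun e he => ?_) hsub
    obtain ⟨a, b, hab, hb, rfl⟩ := (hdiag e he).exists_label u
    rcases hT.maximal a b ((isDiagonal_label u hab hb).1 (hdiag _ he)) with h | ⟨c, d, h, hX⟩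
    · exact ⟨a, b, h, rfl⟩
    · exact absurd ((crosses_label u hab hb (hlt c d h).1 (hlt c d h).2).2 hX)
        (hnc _ he _ (hsub ⟨c, d, h, rfl⟩))

/-- The diagonals at a vertex, together with its ear-cover, form a blocking set. -/
theorem exists_isBlockingSet_ncard_le {n : ℕ} (hn : 4 ≤ n) :
    ∃ B : Set (Sym2 (ZMod n)), IsBlockingSet B ∧ B.ncard + 2 ≤ n := by
  classical
  have : NeZero n := ⟨by omega⟩
  set F := (Finset.Icc 2 (n - 2)).image
    fun i : ℕ => s((0 : ZMod n) + ((0 : ℕ) : ZMod n), (0 : ZMod n) + (i : ZMod n)) with hF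
  set e₀ := s((0 : ZMod n) + ((1 : ℕ) : ZMod n), (0 : ZMod n) + ((n - 1 : ℕ) : ZMod n)) with he₀
  have hcard : (insert e₀ F).card + 2 ≤ n := by
    have h1 := Finset.card_insert_le e₀ F
    have h2 : F.card ≤ (Finset.Icc 2 (n - 2)).card := Finset.card_image_le
    rw [Nat.card_Icc] at h2
    omega
  have hd₀ : IsDiagonal e₀ :=
    (isDiagonal_label 0 (by omega) (by omega)).2 (chord_range.2 (by omega))
  have hfan : ∀ e, IsDiagonal e → (Crosses e e₀ ∨ Crosses e₀ e) → e ∈ F := by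
    intro e he hX
    obtain ⟨a, b, hab, hb, rfl⟩ := he.exists_label 0
    rw [isDiagonal_label 0 hab hb, chord_range] at he
    rw [crosses_label 0 hab hb (by omega) (by omega),
      crosses_label 0 (by omega) (by omega) hab hb] at hX
    unfold Interleave at hX
    obtain rfl : a = 0 := by omega
    exact Finset.mem_image.2 ⟨b, Finset.mem_Icc.2 (by omega), rfl⟩
  refine ⟨(insert e₀ F : Finset _), ⟨fun e he => ?_, fun T hT => ?_⟩, ?_⟩
  · rw [Finset.mem_coe, Finset.mem_insert] at he
    rcases he with rfl | he
    · exact hd₀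
    · obtain ⟨i, hi, rfl⟩ := Finset.mem_image.1 he
      rw [Finset.mem_Icc] at hi
      exact (isDiagonal_label 0 (by omega) (by omega)).2 (chord_range.2 (by omega))
  · by_contra hempty
    have hdisj : ∀ e ∈ T, e ∉ insert e₀ F := fun e heT heF =>
      hempty ⟨e, Finset.mem_coe.2 heF, heT⟩
    have hnc : ∀ e ∈ T, ¬ (Crosses e e₀ ∨ Crosses e₀ e) := fun e he hX =>
      hdisj e he (Finset.mem_insert_of_mem (hfan e (hT.1 e he) hX))
    have hself : ¬ Crosses e₀ e₀ := by
      rw [crosses_label 0 (by omega) (by omega) (by omega) (by omega)]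
      unfold Interleave
      omega
    have heq := hT.2.2 (insert e₀ T) (by
        rintro e (rfl | he)
        · exact hd₀
        · exact hT.1 e he) (by
        rintro e (rfl | he) f (rfl | hf)
        · exact hself
        · exact fun hX => hnc f hf (Or.inr hX)
        · exact fun hX => hnc e he (Or.inl hX)
        · exact hT.2.1 e he f hf) (Set.subset_insert _ _)
    exact hdisj e₀ (heq ▸ Set.mem_insert _ _) (Finset.mem_insert_self _ _)
  · rwa [Set.ncard_coe_finset]

theorem IsBlockingSet.isSmallBlocking {n : ℕ} [NeZero n] {B : Set (Sym2 (ZMod n))}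
    (hB : IsBlockingSet B) (hcard : B.ncard + 2 ≤ n) (u : ZMod n) :
    IsSmallBlocking n fun i k => s(u + (i : ZMod n), u + (k : ZMod n)) ∈ B where
  chord a b hab hb h := (isDiagonal_label u hab hb).1 (hB.1 _ h)
  card_le := by
    refine le_trans (Nat.add_le_add_right ?_ 2) hcard
    rw [← Set.ncard_coe_finset]
    refine Set.ncard_le_ncard_of_injOn
      (fun p : ℕ × ℕ => s(u + (p.1 : ZMod n), u + (p.2 : ZMod n)))
      (fun p hp => (mem_chords.1 hp).2) ?_ (Set.toFinite _)
    intro p hp q hq hpq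
    have hp' := (mem_chords.1 hp).1
    have hq' := (mem_chords.1 hq).1
    rw [chord_range] at hp' hq'
    rcases Sym2.eq_iff.1 hpq with ⟨h1, h2⟩ | ⟨h1, h2⟩
    · exact Prod.ext (label_inj u (by omega) (by omega) h1) (label_inj u (by omega) (by omega) h2)
    · have := label_inj u (by omega) (by omega) h1
      have := label_inj u (by omega) (by omega) h2
      omega
  blocks T hT := by
    obtain ⟨e, heB, a, b, hab, rfl⟩ := hB.2 _ (hT.isTriangulation u)
    exact ⟨a, b, hab, heB⟩

/-- Every blocker of the convex n-gon (n ≥ 4) is, up to rotation, a boundary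
net of m+1 consecutive ear-covers together with beams satisfying the non-crossing condition. -/
theorem blocker_characterization {n : ℕ} (hn : 4 ≤ n)
    (B : Set (Sym2 (ZMod n))) (hB : IsBlocker B) :
    ∃ (a : ZMod n) (m : ℕ) (idx : ℕ → ℕ),
      1 ≤ m ∧ m ≤ n - 3 ∧
      (∀ j ∈ Finset.Icc 1 (n - 3 - m), 1 ≤ idx j ∧ idx j ≤ m + 1) ∧
      B = {e | ∃ t : ℕ, t ≤ m ∧ e = s(a + (t : ZMod n), a + (t : ZMod n) + 2)} ∪
          {e | ∃ j ∈ Finset.Icc 1 (n - 3 - m),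
            e = s(a + ((m + 2 + j : ℕ) : ZMod n), a + ((idx j : ℕ) : ZMod n))} ∧
      (∀ j ∈ Finset.Icc 1 (n - 3 - m), ∀ k ∈ Finset.Icc 1 (n - 3 - m),
        2 ≤ |(idx j : ℤ) - (idx k : ℤ)| →
        ¬ Crosses (s(a + ((m + 2 + j : ℕ) : ZMod n), a + ((idx j : ℕ) : ZMod n)))
                  (s(a + ((m + 2 + k : ℕ) : ZMod n), a + ((idx k : ℕ) : ZMod n)))) := by
  have : NeZero n := ⟨by omega⟩
  obtain ⟨B', hB', hcard'⟩ := exists_isBlockingSet_ncard_le hn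
  have hcard : B.ncard + 2 ≤ n := le_trans (Nat.add_le_add_right (hB.2 B' hB') 2) hcard'
  have hsmall := hB.1.isSmallBlocking hcard
  obtain ⟨a, m, idx, hm, hmn, hidx, hnet, hbeam, htri, hX⟩ :=
    exists_net (R := fun i k : ℕ => s((i : ZMod n), (k : ZMod n)) ∈ B) hn
      (fun i k => by simp) (fun i k h => by rwa [Sym2.eq_swap]) (fun J => by
        simpa only [Nat.cast_add] using hsmall (J : ZMod n))
  refine ⟨(a : ZMod n), m, idx, hm, by omega, fun j hj => ?_, ?_, fun j hj k hk hjk => ?_⟩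
  · rw [Finset.mem_Icc] at hj
    exact hidx j hj.1 (by omega)
  · ext e
    simp only [Set.mem_union, Set.mem_ofPred_eq, Finset.mem_Icc]
    constructor
    · intro he
      obtain ⟨x, y, hxy, hy, rfl⟩ := (hB.1.1 e he).exists_label (a : ZMod n)
      rcases htri x y hxy hy (by simpa only [Nat.cast_add] using he) with
        ⟨hxm, rfl⟩ | ⟨j, hj, hjn, rfl, rfl⟩
      · exact Or.inl ⟨x, hxm, by push_cast; rw [add_assoc]⟩
      · exact Or.inr ⟨j, ⟨hj, by omega⟩, Sym2.eq_swap⟩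
    · rintro (⟨t, ht, rfl⟩ | ⟨j, ⟨hj, hjn⟩, rfl⟩)
      · simpa [add_assoc] using hnet t ht
      · rw [Sym2.eq_swap]
        simpa only [Nat.cast_add] using hbeam j hj (by omega)
  · rw [Finset.mem_Icc] at hj hk
    have h1 := hidx j hj.1 (by omega)
    have h2 := hidx k hk.1 (by omega)
    have h3 := hX j k hj.1
    have h4 := hX k j hk.1
    rw [Sym2.eq_swap, Sym2.eq_swap (a := (a : ZMod n) + ((m + 2 + k : ℕ) : ZMod n)),
      crosses_label _ (by omega) (by omega) (by omega) (by omega)]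
    unfold Interleave
    rw [le_abs] at hjk
    omega

end ConvexBlockers
end

section
/- Let n ≥ 4, let a ∈ ZMod n, let m be an integer with 1 ≤ m ≤ n−3, and let i_1, …, i_{n−3−m} be integers with 1 ≤ i_j ≤ m+1 for all j, such that for all j, k ∈ {1, …, n−3−m}, if |i_j − i_k| ≥ 2 then the diagonals {a+m+2+j, a+i_j} and {a+m+2+k, a+i_k} do not cross. Then the set B = {{a+t, a+t+2} : 0 ≤ t ≤ m} ∪ {{a+m+2+j, a+i_j} : 1 ≤ j ≤ n−3−m} has nonempty intersection with every triangulation of the convex n-gon (i.e., B is a blocking set). -/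
namespace ConvexBlockers

/-- The clockwise distance between two labelled vertices of the polygon. -/
lemma val_add_natCast_sub {n : ℕ} (a : ZMod n) {p q : ℕ} (hp : p < n) (hq : q < n) :
    ((a + (q : ZMod n)) - (a + (p : ZMod n))).val = if p ≤ q then q - p else n + q - p := by
  rw [add_sub_add_left_eq_sub]
  split_ifs with h
  · rw [← Nat.cast_sub h, ZMod.val_natCast, Nat.mod_eq_of_lt (by omega)]
  · have hcast : ((q : ZMod n) - (p : ZMod n)) = ((n + q - p : ℕ) : ZMod n) := by
      rw [Nat.cast_sub (by omega)]
      simp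
    rw [hcast, ZMod.val_natCast, Nat.mod_eq_of_lt (by omega)]

/-- Every vertex has a label `p < n` relative to the base vertex `a`. -/
lemma exists_eq_add_natCast {n : ℕ} (hn : 0 < n) (a x : ZMod n) :
    ∃ p < n, x = a + (p : ZMod n) := by
  have : NeZero n := ⟨hn.ne'⟩
  exact ⟨(x - a).val, ZMod.val_lt _, by simp⟩

/-- Interleaving labels give crossing chords. -/
lemma crosses_of_lt {n : ℕ} (a : ZMod n) {p q r s : ℕ} (hpr : p < r) (hrq : r < q) (hqs : q < s)
    (hs : s < n) :
    Crosses (s(a + (p : ZMod n), a + (q : ZMod n))) (s(a + (r : ZMod n), a + (s : ZMod n))) := by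
  refine ⟨_, _, _, _, rfl, rfl, ?_⟩
  simp (disch := omega) only [Btw, val_add_natCast_sub]
  grind

/-- Crossing chords have interleaving labels. -/
lemma Crosses.interleave {n : ℕ} {a : ZMod n} {p q r s : ℕ} (hpq : p < q) (hq : q < n)
    (hrs : r < s) (hs : s < n)
    (h : Crosses (s(a + (p : ZMod n), a + (q : ZMod n))) (s(a + (r : ZMod n), a + (s : ZMod n)))) :
    (p < r ∧ r < q ∧ q < s) ∨ (r < p ∧ p < s ∧ s < q) := by
  obtain ⟨x, y, z, w, he, hf, h1, h2⟩ := h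
  rw [Sym2.eq_iff] at he hf
  rcases he with ⟨rfl, rfl⟩ | ⟨rfl, rfl⟩ <;> rcases hf with ⟨rfl, rfl⟩ | ⟨rfl, rfl⟩ <;>
    simp (disch := omega) only [Btw, val_add_natCast_sub] at h1 h2 <;> grind

/-- Diagonals in terms of labels. -/
lemma isDiagonal_iff {n : ℕ} (a : ZMod n) {p q : ℕ} (hpq : p < q) (hq : q < n) :
    IsDiagonal (s(a + (p : ZMod n), a + (q : ZMod n))) ↔ p + 2 ≤ q ∧ q + 2 ≤ n + p := by
  constructor
  · rintro ⟨x, y, he, h⟩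
    rw [Sym2.eq_iff] at he
    rcases he with ⟨rfl, rfl⟩ | ⟨rfl, rfl⟩ <;>
      simp (disch := omega) only [cyclicDist, val_add_natCast_sub] at h <;> grind
  · intro h
    refine ⟨_, _, rfl, ?_⟩
    simp (disch := omega) only [cyclicDist, val_add_natCast_sub]
    grind

/-- Every diagonal has labels `p < q < n`. -/
lemma IsDiagonal.exists_labels {n : ℕ} (hn : 0 < n) (a : ZMod n) {e : Sym2 (ZMod n)}
    (he : IsDiagonal e) : ∃ p q : ℕ, p < q ∧ q < n ∧ e = s(a + (p : ZMod n), a + (q : ZMod n)) := by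
  obtain ⟨x, y, rfl, h⟩ := he
  obtain ⟨p, hp, rfl⟩ := exists_eq_add_natCast hn a x
  obtain ⟨q, hq, rfl⟩ := exists_eq_add_natCast hn a y
  rcases lt_trichotomy p q with hpq | rfl | hpq
  · exact ⟨p, q, hpq, hq, rfl⟩
  · simp [cyclicDist] at h
  · exact ⟨q, p, hpq, hp, Sym2.eq_swap⟩

/-- A diagonal crossed by no member of a triangulation belongs to it. -/
lemma IsTriangulation.mem_of_not_interleave {n : ℕ} (hn : 0 < n) (a : ZMod n)
    {T : Set (Sym2 (ZMod n))} (hT : IsTriangulation T) {p q : ℕ} (hpq : p + 2 ≤ q) (hq : q < n)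
    (hqn : q + 2 ≤ n + p)
    (h : ∀ r s : ℕ, r < s → s < n → s(a + (r : ZMod n), a + (s : ZMod n)) ∈ T →
      ¬ (p < r ∧ r < q ∧ q < s) ∧ ¬ (r < p ∧ p < s ∧ s < q)) :
    s(a + (p : ZMod n), a + (q : ZMod n)) ∈ T := by
  obtain ⟨hdiag, hcross, hmax⟩ := hT
  rw [← hmax (insert (s(a + (p : ZMod n), a + (q : ZMod n))) T) ?_ ?_ (Set.subset_insert _ _)]
  · exact Set.mem_insert _ _
  · rintro e (rfl | he)
    · exact (isDiagonal_iff a (by omega) hq).2 ⟨hpq, hqn⟩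
    · exact hdiag e he
  · rintro e (rfl | he) f (rfl | hf) hc
    · have := hc.interleave (by omega) hq (by omega) hq
      omega
    · obtain ⟨r, s, hrs, hs, rfl⟩ := (hdiag f hf).exists_labels hn a
      have := hc.interleave (by omega) hq hrs hs
      have := h r s hrs hs hf
      omega
    · obtain ⟨r, s, hrs, hs, rfl⟩ := (hdiag e he).exists_labels hn a
      have := hc.interleave hrs hs (by omega) hq
      have := h r s hrs hs he
      omega
    · exact hcross e he f hf hc

/-- The combinatorial core, in terms of labels: `D p q` says that the diagonal with labels
`p < q` is in the triangulation, and `f w` is the label of the net vertex joined to `w` by a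
beam. -/
lemma false_of_avoids {n m : ℕ} (hm : m + 3 ≤ n) {D : ℕ → ℕ → Prop} {f : ℕ → ℕ}
    (hdiag : ∀ p q, p < q → q < n → D p q → p + 2 ≤ q ∧ q + 2 ≤ n + p)
    (hcross : ∀ p r q s, p < r → r < q → q < s → s < n → D p q → ¬ D r s)
    (hmax : ∀ p q, p + 2 ≤ q → q < n → q + 2 ≤ n + p →
      (∀ r s, r < s → s < n → D r s → ¬ (p < r ∧ r < q ∧ q < s) ∧ ¬ (r < p ∧ p < s ∧ s < q)) →
      D p q)
    (hf : ∀ w, m + 3 ≤ w → w < n → 1 ≤ f w ∧ f w ≤ m + 1)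
    (hnet : ∀ t ≤ m, ¬ D t (t + 2)) (hbeam : ∀ w, m + 3 ≤ w → w < n → ¬ D (f w) w)
    (hbeams : ∀ x w, m + 3 ≤ x → x < w → w < n → f x + 2 ≤ f w → False)
    (hm1 : 1 ≤ m) : False := by
  -- the first neighbour of `v` after `v + 1` is also joined to `v + 1`
  have happ : ∀ v x, v + 3 ≤ x → x < n → x + 2 ≤ n + v → D v x →
      (∀ y, v < y → y < x → ¬ D v y) → D (v + 1) x := by
    intro v x hvx hxn _ hD hmin
    refine hmax _ _ (by omega) hxn (by omega) fun r s hrs hsn hrsD => ⟨?_, ?_⟩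
    · rintro ⟨h1, h2, h3⟩
      exact hcross v r x s (by omega) h2 h3 hsn hD hrsD
    · rintro ⟨h1, h2, h3⟩
      rcases (show r = v ∨ r < v by omega) with rfl | h
      · exact hmin s hrs h3 hrsD
      · exact hcross r v s x h (by omega) h3 hxn hrsD hD
  have hinside : ∀ d p q, q - p ≤ d → p < q → q ≤ m + 2 → ¬ D p q := by
    intro d
    induction d with
    | zero => intros; omega
    | succ d ih =>
      intro p q hd hpq hq hD
      obtain ⟨h1, h2⟩ := hdiag p q hpq (by omega) hD
      rcases (show q = p + 2 ∨ p + 3 ≤ q by omega) with rfl | h3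
      · exact hnet p (by omega) hD
      · exact ih (p + 1) q (by omega) (by omega) hq
          (happ p q h3 (by omega) h2 hD fun y hy hyq => ih p y (by omega) hy (by omega))
  have hnbr : ∀ v, 1 ≤ v → v ≤ m + 1 → ∃ w, m + 3 ≤ w ∧ w < n ∧ D v w := by
    intro v hv1 hvm
    by_contra! hno
    refine hnet (v - 1) (by omega) (hmax _ _ le_rfl (by omega) (by omega) ?_)
    intro r s hrs hsn hrsD
    constructor
    · rintro ⟨h1, h2, h3⟩
      obtain rfl : r = v := by omega
      rcases (show s ≤ m + 2 ∨ m + 3 ≤ s by omega) with h | h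
      · exact hinside _ _ _ le_rfl hrs h hrsD
      · exact hno s h hsn hrsD
    · rintro ⟨h1, h2, h3⟩
      exact hinside _ _ _ le_rfl hrs (by omega) hrsD
  have happex : ∀ v, 1 ≤ v → v ≤ m → ∃ x, m + 3 ≤ x ∧ x < n ∧ D v x ∧ D (v + 1) x := by
    classical
    intro v hv1 hvm
    have hex := hnbr v hv1 (by omega)
    obtain ⟨h1, h2, h3⟩ := Nat.find_spec hex
    refine ⟨Nat.find hex, h1, h2, h3, happ v _ (by omega) h2 (by omega) h3 fun y hvy hy hD => ?_⟩
    rcases (show y ≤ m + 2 ∨ m + 3 ≤ y by omega) with h | h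
    · exact hinside _ _ _ le_rfl hvy h hD
    · exact Nat.find_min hex hy ⟨h, by omega, hD⟩
  have hsweep : ∀ v, 1 ≤ v → v ≤ m + 1 → ∃ w, m + 3 ≤ w ∧ w < n ∧ D v w ∧ v < f w := by
    intro v hv1
    induction v, hv1 using Nat.le_induction with
    | base =>
      intro hvm
      obtain ⟨w, h1, h2, h3⟩ := hnbr 1 le_rfl hvm
      have := hf w h1 h2
      have : f w ≠ 1 := fun h => hbeam w h1 h2 (h ▸ h3)
      exact ⟨w, h1, h2, h3, by omega⟩
    | succ v hv1 ih =>
      intro hvm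
      obtain ⟨w, h1, h2, h3, h4⟩ := ih (by omega)
      obtain ⟨x, hx1, hx2, hx3, hx4⟩ := happex v hv1 (by omega)
      have hv : f x ≠ v := fun h => hbeam x hx1 hx2 (h ▸ hx3)
      have hv' : f x ≠ v + 1 := fun h => hbeam x hx1 hx2 (h ▸ hx4)
      by_cases hlt : v + 1 < f x
      · exact ⟨x, hx1, hx2, hx4, hlt⟩
      · rcases lt_trichotomy x w with hxw | rfl | hxw
        · exact (hbeams x w hx1 hxw h2 (by omega)).elim
        · omega
        · exact (hcross v (v + 1) w x (by omega) (by omega) hxw hx2 h3 hx4).elim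
  obtain ⟨w, h1, h2, -, h4⟩ := hsweep (m + 1) (by omega) le_rfl
  have := hf w h1 h2
  omega

/-- Any set of the form (boundary net ∪ beams) satisfying the non-crossing
condition meets every triangulation, i.e., is a blocking set. -/
theorem net_union_beams_is_blocking {n : ℕ} (hn : 4 ≤ n) (a : ZMod n) (m : ℕ)
    (hm1 : 1 ≤ m) (hm2 : m ≤ n - 3) (idx : ℕ → ℕ)
    (hidx : ∀ j ∈ Finset.Icc 1 (n - 3 - m), 1 ≤ idx j ∧ idx j ≤ m + 1)
    (hcross : ∀ j ∈ Finset.Icc 1 (n - 3 - m), ∀ k ∈ Finset.Icc 1 (n - 3 - m),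
      2 ≤ |(idx j : ℤ) - (idx k : ℤ)| →
      ¬ Crosses (s(a + ((m + 2 + j : ℕ) : ZMod n), a + ((idx j : ℕ) : ZMod n)))
                (s(a + ((m + 2 + k : ℕ) : ZMod n), a + ((idx k : ℕ) : ZMod n)))) :
    ∀ T : Set (Sym2 (ZMod n)), IsTriangulation T →
      (({e | ∃ t : ℕ, t ≤ m ∧ e = s(a + (t : ZMod n), a + (t : ZMod n) + 2)} ∪
        {e | ∃ j ∈ Finset.Icc 1 (n - 3 - m),
          e = s(a + ((m + 2 + j : ℕ) : ZMod n), a + ((idx j : ℕ) : ZMod n))}) ∩ T).Nonempty := by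
  intro T hT
  by_contra hempty
  have havoid : ∀ e ∈ T, ¬ ((∃ t : ℕ, t ≤ m ∧ e = s(a + (t : ZMod n), a + (t : ZMod n) + 2)) ∨
      ∃ j ∈ Finset.Icc 1 (n - 3 - m),
        e = s(a + ((m + 2 + j : ℕ) : ZMod n), a + ((idx j : ℕ) : ZMod n))) :=
    fun e he h => hempty ⟨e, h, he⟩
  have hmem : ∀ w, m + 3 ≤ w → w < n → w - (m + 2) ∈ Finset.Icc 1 (n - 3 - m) := by
    intro w _ _
    rw [Finset.mem_Icc]
    omega
  refine false_of_avoids (n := n) (m := m) (f := fun w => idx (w - (m + 2)))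
    (D := fun p q => s(a + (p : ZMod n), a + (q : ZMod n)) ∈ T) (by omega)
    (fun p q hpq hq h => (isDiagonal_iff a hpq hq).1 (hT.1 _ h))
    (fun p r q s hpr hrq hqs hs h h' => hT.2.1 _ h _ h' (crosses_of_lt a hpr hrq hqs hs))
    (fun p q hpq hq hqn h => hT.mem_of_not_interleave (by omega) a hpq hq hqn h)
    (fun w hw hwn => hidx _ (hmem w hw hwn)) (fun t ht h => havoid _ h (Or.inl ⟨t, ht, ?_⟩))
    (fun w hw hwn h => havoid _ h (Or.inr ⟨_, hmem w hw hwn, ?_⟩))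
    (fun x w hx hxw hw hlt => ?_) hm1
  · push_cast
    rw [add_assoc]
  · rw [Sym2.eq_swap, Nat.add_sub_cancel' (by omega)]
  · have hx' := hmem x hx (by omega)
    have hw' := hmem w (by omega) hw
    refine hcross _ hx' _ hw' ?_ ?_
    · rw [abs_sub_comm]
      exact le_trans (by omega) (le_abs_self _)
    · rw [Nat.add_sub_cancel' (by omega), Nat.add_sub_cancel' (by omega), Sym2.eq_swap,
        Sym2.eq_swap (a := a + (w : ZMod n))]
      have := hidx _ hw'
      exact crosses_of_lt a (by omega) (by omega) hxw hw

end ConvexBlockers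
end

section
/- Let n ≥ 4 and let B be a blocker for the triangulations of a convex n-gon. Then B has no isolated vertex: for every vertex i ∈ ZMod n there exists a diagonal in B having i as an endpoint. -/
namespace ConvexBlockers

lemma val_sub_eq_ite {n : ℕ} [NeZero n] (a b : ZMod n) :
    (a - b).val = if b.val ≤ a.val then a.val - b.val else a.val + n - b.val := by
  split_ifs with h
  · exact ZMod.val_sub h
  · have h' : (b - a).val = b.val - a.val := ZMod.val_sub (by omega)
    have hne : b - a ≠ 0 := fun h0 => by
      rw [h0, ZMod.val_zero] at h'
      omega
    have : NeZero (b - a) := ⟨hne⟩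
    rw [← neg_sub, ZMod.val_neg_of_ne_zero, h']
    omega

/-- Distances between two vertices, read off from their positions relative to a base vertex. -/
lemma val_sub_eq_ite_base {n : ℕ} [NeZero n] (i a b : ZMod n) :
    (a - b).val = if (b - i).val ≤ (a - i).val then (a - i).val - (b - i).val
      else (a - i).val + n - (b - i).val := by
  rw [← val_sub_eq_ite, sub_sub_sub_cancel_right]

/-- A diagonal avoiding the vertex `i` is crossed by a diagonal at `i`. -/
lemma exists_crosses_of_btw {n : ℕ} [NeZero n] (i a b : ZMod n) (hab : 2 ≤ cyclicDist a b)
    (h : Btw i a b) : ∃ c, 2 ≤ cyclicDist c i ∧ Crosses s(a, b) s(c, i) := by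
  have hc (k : ℕ) (hk : k < n) : ((i + (k : ZMod n)) - i).val = k := by
    rw [add_sub_cancel_left, ZMod.val_cast_of_lt hk]
  have hb := ZMod.val_lt (b - i)
  obtain ⟨h0, h1⟩ := h
  have hc := hc ((a - i).val + 1) (by omega)
  set c : ZMod n := i + (((a - i).val + 1 : ℕ) : ZMod n)
  have hii : (i - i).val = 0 := by simp
  have hdist := hab
  rw [cyclicDist, le_min_iff, val_sub_eq_ite_base i a b, val_sub_eq_ite_base i b a] at hdist
  refine ⟨c, ?_, a, b, c, i, rfl, rfl, ?_, ?_⟩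
  · rw [cyclicDist, le_min_iff, val_sub_eq_ite_base i i c, hc, hii]
    split_ifs at * <;> omega
  · rw [Btw, val_sub_eq_ite_base i c a, val_sub_eq_ite_base i b a, hc]
    split_ifs at * <;> omega
  · rw [Btw, val_sub_eq_ite_base i i b, val_sub_eq_ite_base i a b, hii]
    split_ifs at * <;> omega

lemma cyclicDist_comm {n : ℕ} (i j : ZMod n) : cyclicDist i j = cyclicDist j i :=
  min_comm _ _

/-- All diagonals at a fixed vertex form a triangulation. -/
lemma isTriangulation_star {n : ℕ} [NeZero n] (i : ZMod n) :
    IsTriangulation {e : Sym2 (ZMod n) | IsDiagonal e ∧ i ∈ e} := by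
  refine ⟨fun e he => he.1, ?_, ?_⟩
  · rintro _ ⟨-, he⟩ _ ⟨-, hf⟩ ⟨a, b, c, d, rfl, rfl, ⟨h1, h2⟩, h3, h4⟩
    rw [Sym2.mem_iff] at he hf
    rcases he with rfl | rfl <;> rcases hf with rfl | rfl <;> simp_all
  · intro T' hdiag hcross hsub
    refine Set.Subset.antisymm (fun e he => ⟨hdiag e he, ?_⟩) hsub
    by_contra hi
    have key (a b : ZMod n) (hab : 2 ≤ cyclicDist a b) (hmem : s(a, b) ∈ T')
        (h : Btw i a b) : False := by
      obtain ⟨c, hc, hcr⟩ := exists_crosses_of_btw i a b hab h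
      exact hcross _ hmem _ (hsub ⟨⟨c, i, rfl, hc⟩, Sym2.mem_mk_right c i⟩) hcr
    obtain ⟨a, b, rfl, hab⟩ := hdiag e he
    rw [Sym2.mem_iff, not_or] at hi
    have ha : 0 < (a - i).val := ZMod.val_pos.2 (sub_ne_zero.2 (Ne.symm hi.1))
    have hb : 0 < (b - i).val := ZMod.val_pos.2 (sub_ne_zero.2 (Ne.symm hi.2))
    rcases lt_trichotomy (a - i).val (b - i).val with h | h | h
    · exact key a b hab he ⟨ha, h⟩
    · obtain rfl : a = b := sub_left_injective (ZMod.val_injective n h)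
      simp [cyclicDist] at hab
    · exact key b a (cyclicDist_comm a b ▸ hab) (Sym2.eq_swap ▸ he) ⟨hb, h⟩

/-- No blocker contains an isolated vertex. -/
theorem blocker_no_isolated_vertex {n : ℕ} (hn : 4 ≤ n)
    (B : Set (Sym2 (ZMod n))) (hB : IsBlocker B) :
    ∀ i : ZMod n, ∃ e ∈ B, i ∈ e := by
  intro i
  have : NeZero n := ⟨by omega⟩
  obtain ⟨e, heB, -, hie⟩ := hB.1.2 _ (isTriangulation_star i)
  exact ⟨e, heB, hie⟩

end ConvexBlockers
end

section
/- For every integer n ≥ 1, the Fibonacci numbers satisfy fib(2n) = n + Σ_{k=1}^{n−1} k · fib(2n − 2k), where fib is the Fibonacci sequence with fib 0 = 0 and fib 1 = fib 2 = 1. (Equivalently, in the paper's convention F_0 = 1, F_1 = F_2 = 1: F_{2n} = Σ_{k=1}^{n} k · F_{2n−2k}.) -/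
theorem sum_range_fib_two_mul_add_one (n : ℕ) :
    ∑ j ∈ Finset.range (n + 1), Nat.fib (2 * j) + 1 = Nat.fib (2 * n + 1) := by
  induction n with
  | zero => simp
  | succ n ih =>
    have h : Nat.fib (2 * (n + 1) + 1) = Nat.fib (2 * n + 1) + Nat.fib (2 * (n + 1)) :=
      Nat.fib_add_two
    rw [Finset.sum_range_succ, h]
    omega

theorem fib_two_mul_eq_add_sum_range (n : ℕ) :
    Nat.fib (2 * n) = n + ∑ j ∈ Finset.range (n + 1), (n - j) * Nat.fib (2 * j) := by
  induction n with
  | zero => simp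
  | succ n ih =>
    have hfib : Nat.fib (2 * (n + 1)) = Nat.fib (2 * n) + Nat.fib (2 * n + 1) :=
      Nat.fib_add_two
    have hsum : ∑ j ∈ Finset.range (n + 1), (n + 1 - j) * Nat.fib (2 * j) =
        ∑ j ∈ Finset.range (n + 1), (n - j) * Nat.fib (2 * j) +
          ∑ j ∈ Finset.range (n + 1), Nat.fib (2 * j) := by
      rw [← Finset.sum_add_distrib]
      refine Finset.sum_congr rfl fun j hj => ?_
      rw [Nat.sub_add_comm (Finset.mem_range_succ_iff.mp hj), add_one_mul]
    have hodd := sum_range_fib_two_mul_add_one n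
    rw [Finset.sum_range_succ, hsum, Nat.sub_self, zero_mul, hfib]
    omega

/-- fib(2n) = n + Σ_{k=1}^{n-1} k · fib(2n - 2k) for n ≥ 1. -/
theorem fib_two_mul_sum (n : ℕ) (hn : 1 ≤ n) :
    Nat.fib (2 * n) = n + ∑ k ∈ Finset.Icc 1 (n - 1), k * Nat.fib (2 * n - 2 * k) := by
  rw [fib_two_mul_eq_add_sum_range, ← Finset.sum_range_reflect]
  congr 1
  symm
  refine Finset.sum_subset_zero_on_sdiff (fun k hk => ?_) (fun k hk => ?_) (fun k hk => ?_)
  · simp only [Finset.mem_Icc, Finset.mem_range] at hk ⊢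
    omega
  · simp only [Finset.mem_sdiff, Finset.mem_Icc, Finset.mem_range] at hk
    obtain rfl | rfl : k = 0 ∨ k = n := by omega
    · simp
    · simp
  · simp only [Finset.mem_Icc] at hk
    congr 2 <;> omega
end
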